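/- Under the assumptions that x₁, ..., x_N ∈ ℝ² are non-collinear with xᵢ ≠ x_{i+1}, dᵢ = ‖y* - xᵢ‖, and J, yᵢ, eᵢ defined as in the radical-axis construction, the gradient ∇J(y) = Σ_{i=1}^{N-1} ⟨y - yᵢ, eᵢ⟩ eᵢ vanishes if and only if y = y*. -/

import Mathlib

open RealInnerProductSpace

/-- In a Euclidean plane, a set on which `⟪v, ·⟫` is constant for some `v ≠ 0` is collinear. -/
theorem collinear_of_inner_eq {V : Type*} [NormedAddCommGroup V] [InnerProductSpace ℝ V]
    (hV : Module.finrank ℝ V = 2) {s : Set V} {v : V} (hv : v ≠ 0) {c : ℝ}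
    (hs : ∀ p ∈ s, ⟪v, p⟫ = c) : Collinear ℝ s := by
  have : Fact (Module.finrank ℝ V = 1 + 1) := ⟨hV⟩
  have : FiniteDimensional ℝ V := .of_fact_finrank_eq_succ 1
  rw [collinear_iff_finrank_le_one,
    ← Submodule.finrank_orthogonal_span_singleton (𝕜 := ℝ) (n := 1) hv]
  refine Submodule.finrank_mono (Submodule.span_le.2 ?_)
  rintro _ ⟨p, hp, q, hq, rfl⟩
  simp [Submodule.mem_orthogonal_singleton_iff_inner_right, inner_sub_right, hs p hp, hs q hq]

/-- If `∑ i, ⟪v, e i⟫ • e i = 0`, then `v` is orthogonal to every `e i`. -/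
theorem inner_eq_zero_of_sum_inner_smul_eq_zero {ι V : Type*} [NormedAddCommGroup V]
    [InnerProductSpace ℝ V] {s : Finset ι} {e : ι → V} {v : V}
    (h : ∑ i ∈ s, ⟪v, e i⟫ • e i = 0) : ∀ i ∈ s, ⟪v, e i⟫ = 0 := by
  have hsum : ∑ i ∈ s, ⟪v, e i⟫ * ⟪v, e i⟫ = 0 := by
    simpa [inner_sum, real_inner_smul_right] using congrArg (fun w => ⟪v, w⟫) h
  intro i hi
  exact mul_self_eq_zero.1
    ((Finset.sum_eq_zero_iff_of_nonneg fun _ _ => mul_self_nonneg _).1 hsum i hi)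

/-- The foot of the radical axis of the spheres about `p` and `q` through `z` has the same inner
product with `q - p` as `z` itself. -/
theorem inner_radical_axis_foot {V : Type*} [NormedAddCommGroup V] [InnerProductSpace ℝ V]
    {p q : V} (hpq : p ≠ q) (z : V) :
    ⟪p + ((‖q - p‖ ^ 2 + ‖z - p‖ ^ 2 - ‖z - q‖ ^ 2) / (2 * ‖q - p‖) / ‖q - p‖) • (q - p), q - p⟫
      = ⟪z, q - p⟫ := by
  have hne : ‖q - p‖ ≠ 0 := norm_ne_zero_iff.2 (sub_ne_zero.2 hpq.symm)
  have hz : ‖z - q‖ ^ 2 = ‖z - p‖ ^ 2 - 2 * ⟪z - p, q - p⟫ + ‖q - p‖ ^ 2 := by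
    rw [← norm_sub_sq_real, sub_sub_sub_cancel_right]
  rw [inner_add_left, real_inner_smul_left, real_inner_self_eq_norm_sq, hz, inner_sub_left]
  field_simp
  ring

/-- Under the radical-axis construction with non-collinear sensors and noise-free measurements,
the gradient `∇J(y) = Σᵢ ⟪y - yᵢ, eᵢ⟫ eᵢ` vanishes if and only if `y = y*`. -/
theorem gradient_eq_zero_iff (N : ℕ) (hN : 3 ≤ N)
    (x : ℕ → EuclideanSpace ℝ (Fin 2))
    (hnc : ¬ Collinear ℝ (x '' Set.Iio N))
    (hcons : ∀ i, i + 1 < N → x i ≠ x (i + 1))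
    (ystar : EuclideanSpace ℝ (Fin 2)) (d : ℕ → ℝ)
    (hd : ∀ i, i < N → d i = ‖ystar - x i‖)
    (e : ℕ → EuclideanSpace ℝ (Fin 2)) (he : ∀ i, e i = x (i + 1) - x i)
    (a : ℕ → ℝ) (ha : ∀ i, a i = (‖e i‖ ^ 2 + (d i) ^ 2 - (d (i + 1)) ^ 2) / (2 * ‖e i‖))
    (Y : ℕ → EuclideanSpace ℝ (Fin 2)) (hY : ∀ i, Y i = x i + (a i / ‖e i‖) • e i) :
    ∀ y : EuclideanSpace ℝ (Fin 2),
      (∑ i ∈ Finset.range (N - 1), ⟪y - Y i, e i⟫ • e i) = 0 ↔ y = ystar := by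
  intro y
  have key : ∀ i ∈ Finset.range (N - 1), ⟪y - Y i, e i⟫ = ⟪y - ystar, e i⟫ := by
    intro i hi
    have hi' : i + 1 < N := by have := Finset.mem_range.1 hi; omega
    rw [inner_sub_left, inner_sub_left, hY, ha, hd i (by omega), hd (i + 1) hi', he,
      inner_radical_axis_foot (hcons i hi')]
  rw [Finset.sum_congr rfl fun i hi => by rw [key i hi]]
  refine ⟨fun h => ?_, fun h => by simp [h]⟩
  by_contra hy
  have horth := inner_eq_zero_of_sum_inner_smul_eq_zero h
  have hconst : ∀ i, i < N → ⟪y - ystar, x i⟫ = ⟪y - ystar, x 0⟫ := by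
    intro i
    induction i with
    | zero => intro _; rfl
    | succ k ih =>
      intro hk
      have h0 := horth k (Finset.mem_range.2 (by omega))
      rw [he, inner_sub_right, sub_eq_zero] at h0
      rw [h0, ih (by omega)]
  refine hnc (collinear_of_inner_eq (by simp) (sub_ne_zero.2 hy) (c := ⟪y - ystar, x 0⟫) ?_)
  rintro _ ⟨i, hi, rfl⟩
  exact hconst i hi
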